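/- arXiv:2601.19007 — 4 statements merged into one kernel-verified Lean document; each statement's English description precedes it below -/
import Mathlib

section
/- Let A ∈ ℝ^{n×n} be a symmetric positive definite matrix, and let k ≤ n be a natural number such that max_{i=1,…,n} Σ_{j : |i−j| > k} |A_{ij}| < λ_min(A), where λ_min(A) denotes the smallest eigenvalue of A. Then the cut-off matrix L_k(A) is (symmetric) positive definite. -/
open Matrix BigOperators

/-- The cut-off operator `L_k`: keeps entries within bandwidth `k`, zeroes the rest. -/
def cutoff {n : ℕ} (k : ℕ) (A : Matrix (Fin n) (Fin n) ℝ) :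
    Matrix (Fin n) (Fin n) ℝ :=
  Matrix.of fun i j => if |(i : ℤ) - (j : ℤ)| ≤ (k : ℤ) then A i j else 0

/-- The quadratic form of a real Hermitian matrix is bounded below by any lower bound of its
eigenvalues. -/
theorem mul_dotProduct_self_le_of_le_eigenvalues {ι : Type*} [Fintype ι] [DecidableEq ι]
    {A : Matrix ι ι ℝ} (hA : A.IsHermitian) {c : ℝ} (hc : ∀ i, c ≤ hA.eigenvalues i)
    (x : ι → ℝ) : c * (x ⬝ᵥ x) ≤ x ⬝ᵥ (A *ᵥ x) := by
  have hsub : (A - c • (1 : Matrix ι ι ℝ)).PosSemidef := by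
    have hdiag : (diagonal fun i => hA.eigenvalues i - c).PosSemidef :=
      posSemidef_diagonal_iff.mpr fun i => sub_nonneg.mpr (hc i)
    have hconj := hdiag.mul_mul_conjTranspose_same (hA.eigenvectorUnitary : Matrix ι ι ℝ)
    have hU : (hA.eigenvectorUnitary : Matrix ι ι ℝ) *
        (hA.eigenvectorUnitary : Matrix ι ι ℝ)ᴴ = 1 :=
      Unitary.coe_mul_star_self hA.eigenvectorUnitary
    have hspec : A = (hA.eigenvectorUnitary : Matrix ι ι ℝ) * diagonal hA.eigenvalues *
        (hA.eigenvectorUnitary : Matrix ι ι ℝ)ᴴ := hA.spectral_theorem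
    have hsplit : (diagonal fun i => hA.eigenvalues i - c) =
        diagonal hA.eigenvalues - c • (1 : Matrix ι ι ℝ) := by
      rw [smul_one_eq_diagonal, diagonal_sub]
    rw [hsplit, mul_sub, sub_mul, ← hspec, mul_smul_comm, smul_mul_assoc, mul_one, hU] at hconj
    exact hconj
  have h := hsub.dotProduct_mulVec_nonneg x
  simp only [star_trivial, sub_mulVec, smul_mulVec, one_mulVec, dotProduct_sub,
    dotProduct_smul, smul_eq_mul] at h
  linarith

/-- Schur's test for the quadratic form of a real symmetric matrix. -/
theorem dotProduct_mulVec_le_of_sum_abs_le {ι : Type*} [Fintype ι] {R : Matrix ι ι ℝ}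
    (hR : R.IsSymm) {r : ℝ} (hr : ∀ i, ∑ j, |R i j| ≤ r) (x : ι → ℝ) :
    x ⬝ᵥ (R *ᵥ x) ≤ r * (x ⬝ᵥ x) := by
  have hterm (i j : ι) :
      x i * (R i j * x j) ≤ |R i j| * x i ^ 2 / 2 + |R j i| * x j ^ 2 / 2 := by
    rw [hR.apply i j]
    rcases abs_cases (R i j) with ⟨h, h'⟩ | ⟨h, h'⟩ <;> rw [h]
    · nlinarith [mul_nonneg h' (sq_nonneg (x i - x j))]
    · nlinarith [mul_nonneg (neg_nonneg.mpr h'.le) (sq_nonneg (x i + x j))]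
  calc x ⬝ᵥ (R *ᵥ x) = ∑ i, ∑ j, x i * (R i j * x j) := by
        simp only [dotProduct, mulVec, Finset.mul_sum]
    _ ≤ ∑ i, ∑ j, (|R i j| * x i ^ 2 / 2 + |R j i| * x j ^ 2 / 2) :=
        Finset.sum_le_sum fun i _ => Finset.sum_le_sum fun j _ => hterm i j
    _ = ∑ i, (∑ j, |R i j|) * x i ^ 2 := by
        simp only [Finset.sum_add_distrib]
        rw [Finset.sum_comm (f := fun i j => |R j i| * x j ^ 2 / 2), ← Finset.sum_add_distrib]
        refine Finset.sum_congr rfl fun i _ => ?_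
        rw [← Finset.sum_add_distrib, Finset.sum_mul]
        exact Finset.sum_congr rfl fun j _ => add_halves _
    _ ≤ ∑ i, r * x i ^ 2 :=
        Finset.sum_le_sum fun i _ => mul_le_mul_of_nonneg_right (hr i) (sq_nonneg _)
    _ = r * (x ⬝ᵥ x) := by
        simp only [dotProduct, Finset.mul_sum, sq]

theorem cutoff_isSymm {n : ℕ} (k : ℕ) {A : Matrix (Fin n) (Fin n) ℝ} (hA : A.IsSymm) :
    (cutoff k A).IsSymm := by
  refine IsSymm.ext fun i j => ?_
  simp only [cutoff, of_apply, abs_sub_comm (j : ℤ) (i : ℤ), hA.apply i j]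

theorem sum_abs_sub_cutoff {n : ℕ} (k : ℕ) (A : Matrix (Fin n) (Fin n) ℝ) (i : Fin n) :
    ∑ j, |(A - cutoff k A) i j| =
      ∑ j ∈ Finset.univ.filter (fun j : Fin n => (k : ℤ) < |(i : ℤ) - (j : ℤ)|), |A i j| := by
  rw [Finset.sum_filter]
  refine Finset.sum_congr rfl fun j _ => ?_
  by_cases h : |(i : ℤ) - (j : ℤ)| ≤ (k : ℤ)
  · simp [cutoff, h, not_lt.mpr h]
  · simp [cutoff, h, not_le.mp h]

/-- **Lemma 1 (Positive definiteness of a cut-off matrix).**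
If `A` is symmetric positive definite and `k ≤ n` satisfies
`max_i Σ_{|i-j|>k} |A i j| < λ_min(A)`, then `L_k(A)` is positive definite. -/
theorem cutoff_posDef {n : ℕ} (k : ℕ) (hk : k ≤ n)
    (A : Matrix (Fin n) (Fin n) ℝ) (hA : A.PosDef)
    (hbound :
      (⨆ i : Fin n,
        ∑ j ∈ Finset.univ.filter (fun j : Fin n => (k : ℤ) < |(i : ℤ) - (j : ℤ)|), |A i j|)
      < ⨅ i : Fin n, hA.1.eigenvalues i) :
    (cutoff k A).PosDef := by
  have hsymm : A.IsSymm := isHermitian_iff_isSymm.mp hA.1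
  have hcut := cutoff_isSymm k hsymm
  refine PosDef.of_dotProduct_mulVec_pos (isHermitian_iff_isSymm.mpr hcut) fun x hx => ?_
  have hlower := mul_dotProduct_self_le_of_le_eigenvalues hA.1
    (fun i => ciInf_le (Set.finite_range _).bddBelow i) x
  have hupper := dotProduct_mulVec_le_of_sum_abs_le (hsymm.sub hcut)
    (fun i => (sum_abs_sub_cutoff k A i).trans_le
      (le_ciSup (f := fun i : Fin n => ∑ j ∈ Finset.univ.filter
        (fun j : Fin n => (k : ℤ) < |(i : ℤ) - (j : ℤ)|), |A i j|)
        (Set.finite_range _).bddAbove i)) x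
  have hpos : 0 < x ⬝ᵥ x := by simpa using dotProduct_star_self_pos_iff.mpr hx
  have hgap := mul_lt_mul_of_pos_right hbound hpos
  rw [sub_mulVec, dotProduct_sub] at hupper
  rw [star_trivial]
  linarith
end

section
/- Let x_1 < ⋯ < x_n be real points, let σ² > 0, ℓ² > 0, σ_n² > 0, and set δ = min_{i≠j} |x_i − x_j| > 0. Let K_θ ∈ ℝ^{n×n} be the squared-exponential Gram matrix (K_θ)_{ij} = σ² exp(−(x_i − x_j)²/(2ℓ²)). Suppose k ∈ ℕ with k ≤ n is chosen such that there exists ε with (K_θ)_{ij} ≤ ε for all pairs with |i−j| > k and ε ≤ (3 σ_n² δ²)/(4 ℓ²) · exp(−3δ²/(2ℓ²)). Then the matrix L_k(K_θ + σ_n² I) = L_k(K_θ) + σ_n² I is positive definite. -/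
open Matrix BigOperators

/-- The squared-exponential Gram matrix `(K_θ)_{ij} = σ² exp(−(x_i−x_j)²/(2ℓ²))`. -/
noncomputable def seGram {n : ℕ} (x : Fin n → ℝ) (σ2 l2 : ℝ) :
    Matrix (Fin n) (Fin n) ℝ :=
  Matrix.of fun i j => σ2 * Real.exp (-(x i - x j) ^ 2 / (2 * l2))

lemma Finset.sum_pow_le_inv_one_sub {ι : Type*} (s : Finset ι) (g : ι → ℕ)
    (hg : Set.InjOn g s) {q : ℝ} (hq0 : 0 ≤ q) (hq1 : q < 1) :
    ∑ j ∈ s, q ^ g j ≤ (1 - q)⁻¹ := by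
  rw [← tsum_geometric_of_lt_one hq0 hq1, ← Finset.sum_image (f := fun m => q ^ m) hg]
  exact (summable_geometric_of_lt_one hq0 hq1).sum_le_tsum _ fun _ _ => pow_nonneg hq0 _

lemma sum_mul_exp_mul_nonneg {ι : Type*} [Fintype ι] (x v : ι → ℝ) {c : ℝ} (hc : 0 ≤ c) :
    0 ≤ ∑ i, ∑ j, v i * v j * Real.exp (c * (x i * x j)) := by
  have h : HasSum (fun m : ℕ => ∑ i, ∑ j, v i * v j * ((c * (x i * x j)) ^ m / m.factorial))
      (∑ i, ∑ j, v i * v j * Real.exp (c * (x i * x j))) := by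
    refine hasSum_sum fun i _ => hasSum_sum fun j _ => HasSum.mul_left _ ?_
    rw [Real.exp_eq_exp_ℝ]
    exact NormedSpace.expSeries_div_hasSum_exp _
  refine h.nonneg fun m => ?_
  have : ∑ i, ∑ j, v i * v j * ((c * (x i * x j)) ^ m / m.factorial)
      = c ^ m / m.factorial * (∑ i, v i * x i ^ m) ^ 2 := by
    rw [sq, Finset.sum_mul_sum, Finset.mul_sum]
    refine Finset.sum_congr rfl fun i _ => ?_
    rw [Finset.mul_sum]
    refine Finset.sum_congr rfl fun j _ => ?_
    rw [mul_pow, mul_pow]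
    ring
  rw [this]
  positivity

lemma seGram_apply {n : ℕ} (x : Fin n → ℝ) (σ2 l2 : ℝ) (i j : Fin n) :
    seGram x σ2 l2 i j = σ2 * Real.exp (-(x i - x j) ^ 2 / (2 * l2)) := rfl

lemma seGram_comm {n : ℕ} (x : Fin n → ℝ) (σ2 l2 : ℝ) (i j : Fin n) :
    seGram x σ2 l2 i j = seGram x σ2 l2 j i := by
  rw [seGram_apply, seGram_apply, ← neg_sub, neg_sq]

lemma seGram_pos {n : ℕ} (x : Fin n → ℝ) {σ2 : ℝ} (l2 : ℝ) (hσ2 : 0 < σ2) (i j : Fin n) :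
    0 < seGram x σ2 l2 i j :=
  mul_pos hσ2 (Real.exp_pos _)

lemma seGram_quadForm_nonneg {n : ℕ} (x v : Fin n → ℝ) {σ2 l2 : ℝ} (hσ2 : 0 ≤ σ2)
    (hl2 : 0 < l2) : 0 ≤ ∑ i, ∑ j, v i * v j * seGram x σ2 l2 i j := by
  refine (mul_nonneg hσ2 (sum_mul_exp_mul_nonneg x
    (fun i => v i * Real.exp (-(x i) ^ 2 / (2 * l2))) (inv_nonneg.2 hl2.le))).trans_eq ?_
  simp only [Finset.mul_sum, seGram_apply]
  refine Finset.sum_congr rfl fun i _ => Finset.sum_congr rfl fun j _ => ?_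
  have : -(x i - x j) ^ 2 / (2 * l2)
      = -(x i) ^ 2 / (2 * l2) + -(x j) ^ 2 / (2 * l2) + l2⁻¹ * (x i * x j) := by
    field_simp
    ring
  rw [this, Real.exp_add, Real.exp_add]
  ring

lemma natCast_mul_le_sub_of_separated {n : ℕ} {x : Fin n → ℝ} (hx : StrictMono x) {δ : ℝ}
    (hδ : ∀ i j, i ≠ j → δ ≤ |x i - x j|) (m : ℕ) (i j : Fin n) (h : (j : ℕ) = i + m) :
    m * δ ≤ x j - x i := by
  induction m generalizing j with
  | zero =>
    obtain rfl : j = i := Fin.ext h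
    simp
  | succ m ih =>
    let c : Fin n := ⟨i + m, by omega⟩
    have hcj : c < j := Fin.lt_def.2 (by simp only [c]; omega)
    have h₁ := ih c rfl
    have h₂ := hδ j c hcj.ne'
    rw [abs_of_pos (sub_pos.2 (hx hcj))] at h₂
    push_cast
    linarith

/-- Beyond the band, the entries of the Gram matrix decay geometrically in a row. -/
lemma seGram_le_mul_pow {n : ℕ} {k : ℕ} {x : Fin n → ℝ} (hx : StrictMono x)
    {σ2 l2 δ B : ℝ} (hσ2 : 0 < σ2) (hl2 : 0 < l2) (hδ0 : 0 < δ)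
    (hδ : ∀ i j, i ≠ j → δ ≤ |x i - x j|)
    (hB : ∀ i j : Fin n, (k : ℤ) < |(i : ℤ) - (j : ℤ)| → seGram x σ2 l2 i j ≤ B)
    (i j : Fin n) (h : (i : ℕ) + k < j) :
    seGram x σ2 l2 i j ≤ B * Real.exp (-(3 * δ ^ 2) / (2 * l2)) ^ ((j : ℕ) - (i + k + 1)) := by
  obtain ⟨m, hm⟩ : ∃ m, (j : ℕ) = i + k + 1 + m := ⟨j - (i + k + 1), by omega⟩
  let c : Fin n := ⟨i + k + 1, by omega⟩
  have hic : i < c := Fin.lt_def.2 (by simp only [c]; omega)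
  have hcB : seGram x σ2 l2 i c ≤ B := hB i c (by simp only [c]; rw [lt_abs]; right; push_cast; omega)
  have hd := hδ c i hic.ne'
  rw [abs_of_pos (sub_pos.2 (hx hic))] at hd
  have he := natCast_mul_le_sub_of_separated hx hδ m c j hm
  have hm2 : (m : ℝ) ≤ m * m := by exact_mod_cast Nat.le_mul_self m
  have hmδ : 0 ≤ m * δ := by positivity
  have hsq : (x i - x c) ^ 2 + m * (3 * δ ^ 2) ≤ (x i - x j) ^ 2 := by
    have h₁ : δ * (m * δ) ≤ (x c - x i) * (x j - x c) := mul_le_mul hd he hmδ (hδ0.le.trans hd)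
    have h₂ : (m * δ) * (m * δ) ≤ (x j - x c) * (x j - x c) := mul_le_mul he he hmδ (hmδ.trans he)
    have h₃ : m * δ ^ 2 ≤ m * m * δ ^ 2 := mul_le_mul_of_nonneg_right hm2 (sq_nonneg δ)
    nlinarith
  rw [show (j : ℕ) - (i + k + 1) = m by omega]
  refine le_trans ?_ (mul_le_mul_of_nonneg_right hcB (by positivity))
  rw [seGram_apply, seGram_apply, mul_assoc, ← Real.exp_nat_mul, ← Real.exp_add]
  refine mul_le_mul_of_nonneg_left (Real.exp_le_exp.2 ?_) hσ2.le
  rw [← mul_div_assoc, ← add_div]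
  gcongr
  linarith

lemma mul_exp_neg_mul_inv_one_sub_lt_one {t : ℝ} (ht : 0 < t) :
    t * Real.exp (-t) * (1 - Real.exp (-t))⁻¹ < 1 := by
  have h1 : Real.exp (-t) < 1 := Real.exp_lt_one_iff.2 (by linarith)
  rw [← div_eq_mul_inv, div_lt_one (by linarith)]
  have h2 := Real.add_one_lt_exp ht.ne'
  have h3 : Real.exp t * Real.exp (-t) = 1 := by rw [← Real.exp_add]; simp
  nlinarith [Real.exp_pos (-t)]

/-- The part of the Gram matrix discarded by the cut-off has row sums below the noise level. -/
lemma sum_seGram_off_band_lt {n : ℕ} {k : ℕ} {x : Fin n → ℝ} (hx : StrictMono x)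
    {σ2 l2 σn2 δ : ℝ} (hσ2 : 0 < σ2) (hl2 : 0 < l2) (hσn2 : 0 < σn2) (hδ0 : 0 < δ)
    (hδ : ∀ i j, i ≠ j → δ ≤ |x i - x j|)
    (hB : ∀ i j : Fin n, (k : ℤ) < |(i : ℤ) - (j : ℤ)| → seGram x σ2 l2 i j ≤
      3 * σn2 * δ ^ 2 / (4 * l2) * Real.exp (-(3 * δ ^ 2) / (2 * l2))) (i : Fin n) :
    ∑ j : Fin n, (if (k : ℤ) < |(i : ℤ) - (j : ℤ)| then seGram x σ2 l2 i j else 0) < σn2 := by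
  set q := Real.exp (-(3 * δ ^ 2) / (2 * l2)) with hq
  set B := 3 * σn2 * δ ^ 2 / (4 * l2) * q with hBdef
  have hB0 : 0 ≤ B := by positivity
  have ht : 0 < 3 * δ ^ 2 / (2 * l2) := by positivity
  have hq0 : 0 ≤ q := (Real.exp_pos _).le
  have hq1 : q < 1 := Real.exp_lt_one_iff.2 (by rw [neg_div]; linarith)
  have hright := Finset.sum_pow_le_inv_one_sub (Finset.univ.filter fun j : Fin n => (i : ℕ) + k < j)
    (fun j => (j : ℕ) - (i + k + 1))
    (fun a ha b hb hab => by
      simp only [Finset.coe_filter, Finset.mem_univ, true_and, Set.mem_ofPred_eq] at ha hb hab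
      exact Fin.ext (by omega)) hq0 hq1
  have hleft := Finset.sum_pow_le_inv_one_sub (Finset.univ.filter fun j : Fin n => (j : ℕ) + k < i)
    (fun j => (i : ℕ) - (j + k + 1))
    (fun a ha b hb hab => by
      simp only [Finset.coe_filter, Finset.mem_univ, true_and, Set.mem_ofPred_eq] at ha hb hab
      exact Fin.ext (by omega)) hq0 hq1
  calc _ ≤ ∑ j : Fin n, ((if (i : ℕ) + k < j then B * q ^ ((j : ℕ) - (i + k + 1)) else 0)
        + if (j : ℕ) + k < i then B * q ^ ((i : ℕ) - (j + k + 1)) else 0) := by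
        refine Finset.sum_le_sum fun j _ => ?_
        have hnn : ∀ m : ℕ, 0 ≤ B * q ^ m := fun m => by positivity
        split_ifs with h h₁ h₂ h₂ h₁ h₂ h₂
        · omega
        · simpa using seGram_le_mul_pow hx hσ2 hl2 hδ0 hδ hB i j h₁
        · rw [seGram_comm]
          simpa using seGram_le_mul_pow hx hσ2 hl2 hδ0 hδ hB j i h₂
        · rw [lt_abs] at h
          omega
        all_goals first | exact add_nonneg (hnn _) (hnn _) | simp [hnn]
    _ = B * ((∑ j ∈ Finset.univ.filter fun j : Fin n => (i : ℕ) + k < j, q ^ ((j : ℕ) - (i + k + 1)))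
        + ∑ j ∈ Finset.univ.filter fun j : Fin n => (j : ℕ) + k < i, q ^ ((i : ℕ) - (j + k + 1))) := by
        rw [Finset.sum_add_distrib, ← Finset.sum_filter, ← Finset.sum_filter, ← Finset.mul_sum,
          ← Finset.mul_sum, mul_add]
    _ ≤ B * ((1 - q)⁻¹ + (1 - q)⁻¹) := by gcongr
    _ = σn2 * (3 * δ ^ 2 / (2 * l2) * q * (1 - q)⁻¹) := by
        rw [hBdef]
        field_simp
        ring
    _ < σn2 := by
        have := mul_exp_neg_mul_inv_one_sub_lt_one ht
        rw [← neg_div, ← hq] at this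
        exact mul_lt_of_lt_one_right hσn2 this

lemma sum_mul_mul_le_of_symm {ι : Type*} [Fintype ι] {R : ι → ι → ℝ} (hR : ∀ i j, R i j = R j i)
    (hR0 : ∀ i j, 0 ≤ R i j) (v : ι → ℝ) :
    ∑ i, ∑ j, v i * v j * R i j ≤ ∑ i, v i ^ 2 * ∑ j, R i j := by
  have hswap : ∑ i, ∑ j, v j ^ 2 * R i j = ∑ i, ∑ j, v i ^ 2 * R i j := by
    rw [Finset.sum_comm]
    simp_rw [hR]
  have h : ∑ i, ∑ j, 2 * (v i * v j * R i j) ≤ ∑ i, ∑ j, (v i ^ 2 * R i j + v j ^ 2 * R i j) :=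
    Finset.sum_le_sum fun i _ => Finset.sum_le_sum fun j _ => by
      nlinarith [mul_nonneg (sq_nonneg (v i - v j)) (hR0 i j)]
  simp_rw [Finset.sum_add_distrib, hswap, ← Finset.mul_sum] at h
  linarith

/-- **Theorem 1 (Positive definiteness of a cut-off SE-kernel matrix with noise).**
If every entry of the SE Gram matrix outside the band of width `k` is at most
`ε ≤ (3σ_n²δ²/(4ℓ²)) exp(−3δ²/(2ℓ²))`, then `L_k(K_θ + σ_n² I)` is positive definite. -/
theorem cutoff_seGram_add_noise_posDef {n : ℕ} (k : ℕ) (hk : k ≤ n)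
    (x : Fin n → ℝ) (hx : StrictMono x)
    (σ2 l2 σn2 δ : ℝ) (hσ2 : 0 < σ2) (hl2 : 0 < l2) (hσn2 : 0 < σn2)
    (hδ : IsLeast {d : ℝ | ∃ i j : Fin n, i ≠ j ∧ d = |x i - x j|} δ) (hδ0 : 0 < δ)
    (ε : ℝ)
    (hε : ∀ i j : Fin n, (k : ℤ) < |(i : ℤ) - (j : ℤ)| → seGram x σ2 l2 i j ≤ ε)
    (hεbound : ε ≤ 3 * σn2 * δ ^ 2 / (4 * l2) * Real.exp (-(3 * δ ^ 2) / (2 * l2))) :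
    (cutoff k (seGram x σ2 l2 + σn2 • (1 : Matrix (Fin n) (Fin n) ℝ))).PosDef := by
  have hsep : ∀ i j, i ≠ j → δ ≤ |x i - x j| := fun i j hij => hδ.2 ⟨i, j, hij, rfl⟩
  set R : Fin n → Fin n → ℝ := fun i j =>
    if (k : ℤ) < |(i : ℤ) - (j : ℤ)| then seGram x σ2 l2 i j else 0 with hR
  have hRsymm : ∀ i j, R i j = R j i := fun i j => by
    simp only [hR]
    rw [abs_sub_comm, seGram_comm]
  have hR0 : ∀ i j, 0 ≤ R i j := fun i j => by
    simp only [hR]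
    split_ifs
    exacts [(seGram_pos x l2 hσ2 i j).le, le_rfl]
  have hrow : ∀ i, ∑ j, R i j < σn2 :=
    sum_seGram_off_band_lt hx hσ2 hl2 hσn2 hδ0 hsep fun i j h => (hε i j h).trans hεbound
  have hentry : ∀ i j, cutoff k (seGram x σ2 l2 + σn2 • (1 : Matrix (Fin n) (Fin n) ℝ)) i j
      = seGram x σ2 l2 i j - R i j + if i = j then σn2 else 0 := fun i j => by
    simp only [cutoff, hR, Matrix.of_apply, Matrix.add_apply, Matrix.smul_apply, Matrix.one_apply,
      smul_eq_mul, mul_ite, mul_one, mul_zero]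
    rcases eq_or_ne i j with rfl | hij
    · simp [(Nat.cast_nonneg k : (0 : ℤ) ≤ k).not_gt]
    · rcases le_or_gt |(i : ℤ) - (j : ℤ)| (k : ℤ) with h | h
      · simp [hij, h, h.not_gt]
      · simp [hij, h, h.not_ge]
  refine Matrix.PosDef.of_dotProduct_mulVec_pos ?_ fun v hv => ?_
  · ext i j
    rw [Matrix.conjTranspose_apply, star_trivial, hentry, hentry, hRsymm, seGram_comm]
    simp only [eq_comm]
  · have hform : star v ⬝ᵥ
        (cutoff k (seGram x σ2 l2 + σn2 • (1 : Matrix (Fin n) (Fin n) ℝ))) *ᵥ v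
        = ∑ i, ∑ j, v i * v j * seGram x σ2 l2 i j - ∑ i, ∑ j, v i * v j * R i j
          + ∑ i, v i ^ 2 * σn2 := by
      simp only [dotProduct, mulVec, star_trivial, hentry, Finset.mul_sum]
      rw [← Finset.sum_sub_distrib, ← Finset.sum_add_distrib]
      refine Finset.sum_congr rfl fun i _ => ?_
      have hdiag : v i ^ 2 * σn2 = ∑ j, v i * v j * if i = j then σn2 else 0 := by
        simp [sq]
      rw [hdiag, ← Finset.sum_sub_distrib, ← Finset.sum_add_distrib]
      exact Finset.sum_congr rfl fun j _ => by ring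
    rw [hform]
    have hK := seGram_quadForm_nonneg x v hσ2.le hl2
    have hle := sum_mul_mul_le_of_symm hRsymm hR0 v
    obtain ⟨i₀, hi₀⟩ := Function.ne_iff.1 hv
    have hlt : ∑ i, v i ^ 2 * ∑ j, R i j < ∑ i, v i ^ 2 * σn2 :=
      Finset.sum_lt_sum (fun i _ => mul_le_mul_of_nonneg_left (hrow i).le (sq_nonneg _))
        ⟨i₀, Finset.mem_univ _, mul_lt_mul_of_pos_left (hrow i₀) (sq_pos_of_ne_zero hi₀)⟩
    linarith
end

section
/- Let x_1 < ⋯ < x_n be real training points with δ = min_{i≠j} |x_i − x_j| > 0, let σ² > 0, ℓ² > 0, σ_n² > 0, and let K_{f,f} ∈ ℝ^{n×n} be the squared-exponential Gram matrix of the training points. Suppose k ≤ n is chosen such that there exists ε with (K_{f,f})_{ij} ≤ ε for all |i−j| > k and ε ≤ (3σ_n²δ²)/(4ℓ²)·exp(−3δ²/(2ℓ²)). Let x*_1, …, x*_p be test points that are pairwise distinct and distinct from all training points, with cross-Gram matrices K_{∗,∗}, K_{f,∗}, K_{∗,f} = K_{f,∗}^⊤ from the same squared-exponential kernel. Then the (n+p)×(n+p)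 block matrix [[L_k(K_{f,f}) + σ_n² I, K_{f,∗}], [K_{∗,f}, K_{∗,∗}]] is positive definite. -/
open Matrix BigOperators

/-- Matrix of pairwise squared-exponential kernel evaluations between two point sets. -/
noncomputable def seCross {n p : ℕ} (x : Fin n → ℝ) (y : Fin p → ℝ) (σ2 l2 : ℝ) :
    Matrix (Fin n) (Fin p) ℝ :=
  Matrix.of fun i j => σ2 * Real.exp (-(x i - y j) ^ 2 / (2 * l2))

open Finset

/-- The squared-exponential Gram matrix of finitely many distinct points is positive definite. -/
lemma squaredExponential_posDef {ι : Type*} [Fintype ι] {z : ι → ℝ} (hz : Function.Injective z)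
    {σ2 l2 : ℝ} (hσ2 : 0 < σ2) (hl2 : 0 < l2) :
    (Matrix.of fun i j => σ2 * Real.exp (-(z i - z j) ^ 2 / (2 * l2))).PosDef := by
  refine .of_dotProduct_mulVec_pos ?_ fun c hc => ?_
  · ext i j
    simp [sub_sq_comm (z j) (z i)]
  set w : ι → ℝ := fun i => c i * Real.exp (-z i ^ 2 / (2 * l2)) with hw
  set a : ℕ → ℝ := fun m => σ2 * ((∑ i, w i * z i ^ m) ^ 2 / (l2 ^ m * m.factorial)) with ha
  have hsum : HasSum a (star c ⬝ᵥ (Matrix.of fun i j =>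
      σ2 * Real.exp (-(z i - z j) ^ 2 / (2 * l2))) *ᵥ c) := by
    have hexp (i j : ι) : HasSum (fun m : ℕ => σ2 * (w i * w j) *
        ((z i * z j / l2) ^ m / m.factorial))
        (c i * (σ2 * Real.exp (-(z i - z j) ^ 2 / (2 * l2)) * c j)) := by
      have h := (NormedSpace.expSeries_div_hasSum_exp (z i * z j / l2)).mul_left (σ2 * (w i * w j))
      rw [← Real.exp_eq_exp_ℝ] at h
      convert! h using 1
      have : Real.exp (-(z i - z j) ^ 2 / (2 * l2)) = Real.exp (-z i ^ 2 / (2 * l2)) *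
          Real.exp (-z j ^ 2 / (2 * l2)) * Real.exp (z i * z j / l2) := by
        rw [← Real.exp_add, ← Real.exp_add]
        congr 1
        field_simp
        ring
      rw [this, hw]
      ring
    have h := hasSum_sum (s := univ) fun i _ => hasSum_sum (s := univ) fun j _ => hexp i j
    convert! h using 1
    · ext m
      simp only [ha]
      rw [sq, sum_mul_sum]
      simp only [sum_div, mul_sum]
      refine sum_congr rfl fun i _ => sum_congr rfl fun j _ => ?_
      rw [div_pow, mul_pow]
      field_simp
    · simp [dotProduct, mulVec, mul_sum]
  have hnonneg (m : ℕ) : 0 ≤ a m := by positivity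
  refine (hsum.nonneg hnonneg).lt_of_ne fun h0 => hc ?_
  rw [← h0] at hsum
  have hzero := (hasSum_zero_iff_of_nonneg hnonneg).mp hsum
  have hmoment (m : ℕ) : ∑ i, w i * z i ^ m = 0 := by
    have h := congrFun hzero m
    have hd : l2 ^ m * (m.factorial : ℝ) ≠ 0 := by positivity
    simpa [ha, hσ2.ne', hl2.ne', Nat.factorial_ne_zero] using h
  let e := Fintype.equivFin ι
  have hw0 : w ∘ e.symm = 0 :=
    eq_zero_of_forall_pow_sum_mul_pow_eq_zero (hz.comp e.symm.injective) fun m => by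
      rw [← hmoment m]
      exact e.symm.sum_comp fun i => w i * z i ^ (m : ℕ)
  ext i
  have h := congrFun hw0 (e i)
  simpa [hw] using h

/-- A symmetric matrix with nonnegative entries and row sums at most `s` satisfies `E ≤ s • 1`. -/
lemma smul_one_sub_posSemidef_of_sum_le {ι : Type*} [Fintype ι] [DecidableEq ι]
    {E : Matrix ι ι ℝ} (hE : E.IsHermitian) (hnonneg : ∀ i j, 0 ≤ E i j) {s : ℝ}
    (hs : ∀ i, ∑ j, E i j ≤ s) : (s • (1 : Matrix ι ι ℝ) - E).PosSemidef := by
  refine .of_dotProduct_mulVec_nonneg ?_ fun c => ?_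
  · exact (show (s • (1 : Matrix ι ι ℝ)).IsHermitian by simp [IsHermitian]).sub hE
  have hsymm (i j : ι) : E j i = E i j := by simpa using hE.apply i j
  have hbound : c ⬝ᵥ E *ᵥ c ≤ ∑ i, s * c i ^ 2 := by
    calc c ⬝ᵥ E *ᵥ c = ∑ i, ∑ j, E i j * (c i * c j) := by
          simp only [dotProduct, mulVec, mul_sum]
          exact sum_congr rfl fun i _ => sum_congr rfl fun j _ => by ring
      _ ≤ ∑ i, ∑ j, (E i j * c i ^ 2 / 2 + E i j * c j ^ 2 / 2) := by
          gcongr with i _ j _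
          nlinarith [mul_nonneg (hnonneg i j) (sq_nonneg (c i - c j))]
      _ = ∑ i, (∑ j, E i j) * c i ^ 2 := by
          simp only [sum_add_distrib]
          rw [sum_comm (f := fun i j => E i j * c j ^ 2 / 2), ← sum_add_distrib]
          refine sum_congr rfl fun i _ => ?_
          rw [sum_mul, ← sum_add_distrib]
          exact sum_congr rfl fun j _ => by rw [hsymm i j]; ring
      _ ≤ ∑ i, s * c i ^ 2 := by
          gcongr with i _
          exact hs i
  have hdiag : c ⬝ᵥ (s • (1 : Matrix ι ι ℝ)) *ᵥ c = ∑ i, s * c i ^ 2 := by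
    rw [smul_mulVec, one_mulVec]
    simp only [dotProduct, Pi.smul_apply, smul_eq_mul]
    exact sum_congr rfl fun i _ => by ring
  rw [star_trivial, sub_mulVec, dotProduct_sub, hdiag]
  linarith

lemma fromBlocks_zero_posSemidef {m p : Type*} [Fintype m] [Fintype p]
    {A : Matrix m m ℝ} (hA : A.PosSemidef) :
    (fromBlocks A 0 0 (0 : Matrix p p ℝ)).PosSemidef := by
  refine .of_dotProduct_mulVec_nonneg ?_ fun c => ?_
  · exact hA.1.fromBlocks (by simp) isHermitian_zero
  have h := hA.dotProduct_mulVec_nonneg (c ∘ Sum.inl)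
  rw [fromBlocks_mulVec]
  simpa [dotProduct, Fintype.sum_sum_type] using h

/-- The terms of a geometric distribution on `ℕ`, summed along an injective family of indices,
add up to at most one. -/
lemma sum_pow_mul_one_sub_le_one {ι : Type*} {s : Finset ι} {e : ι → ℕ}
    (he : Set.InjOn e s) {q : ℝ} (hq0 : 0 ≤ q) (hq1 : q ≤ 1) :
    ∑ j ∈ s, q ^ e j * (1 - q) ≤ 1 := by
  obtain ⟨N, hN⟩ := (s.image e).exists_nat_subset_range
  calc ∑ j ∈ s, q ^ e j * (1 - q) = ∑ r ∈ s.image e, q ^ r * (1 - q) :=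
        (sum_image (f := fun r => q ^ r * (1 - q)) he).symm
    _ ≤ ∑ r ∈ range N, q ^ r * (1 - q) :=
        sum_le_sum_of_subset_of_nonneg hN fun r _ _ =>
          mul_nonneg (pow_nonneg hq0 r) (sub_nonneg.mpr hq1)
    _ = 1 - q ^ N := by rw [← sum_mul, geom_sum_mul_neg]
    _ ≤ 1 := sub_le_self _ (pow_nonneg hq0 N)

lemma nat_mul_le_sub_of_gap {n : ℕ} {x : Fin n → ℝ} {δ : ℝ}
    (hgap : ∀ i j, i < j → δ ≤ x j - x i) (r : ℕ) {i j : Fin n} (hij : (j : ℕ) = i + r) :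
    r * δ ≤ x j - x i := by
  induction r generalizing j with
  | zero =>
    have : j = i := Fin.ext hij
    simp [this]
  | succ r ih =>
    have hr : (i : ℕ) + r < n := by have := j.isLt; omega
    have h₁ := ih (j := ⟨i + r, hr⟩) rfl
    have h₂ := hgap ⟨i + r, hr⟩ j (Fin.lt_def.mpr (by simp only; omega))
    push_cast
    linarith

lemma seCross_symm {n p : ℕ} (x : Fin n → ℝ) (y : Fin p → ℝ) (σ2 l2 : ℝ) (i : Fin n)
    (j : Fin p) : seCross y x σ2 l2 j i = seCross x y σ2 l2 i j := by
  simp [seCross, sub_sq_comm (y j) (x i)]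

/-- Squared-exponential kernel values decay geometrically away from the band. -/
lemma seCross_le_mul_pow {n : ℕ} {x : Fin n → ℝ} {σ2 l2 δ : ℝ} (hσ2 : 0 ≤ σ2) (hl2 : 0 < l2)
    (hδ0 : 0 ≤ δ) (hgap : ∀ i j, i < j → δ ≤ x j - x i) {i m j : Fin n} (him : i < m) {r : ℕ}
    (hmj : (j : ℕ) = m + r) :
    seCross x x σ2 l2 i j ≤
      seCross x x σ2 l2 i m * Real.exp (-(3 * δ ^ 2) / (2 * l2)) ^ r := by
  have hu := hgap i m him
  have hv := nat_mul_le_sub_of_gap hgap r hmj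
  have hr0 : (0 : ℝ) ≤ r := r.cast_nonneg
  have hr : (r : ℝ) ≤ (r : ℝ) ^ 2 := mod_cast Nat.le_self_pow two_ne_zero r
  have hsq : (x i - x m) ^ 2 + r * (3 * δ ^ 2) ≤ (x i - x j) ^ 2 := by
    have hrδ : 0 ≤ r * δ := by positivity
    have h₁ : δ * (r * δ) ≤ (x m - x i) * (x j - x m) :=
      mul_le_mul hu hv hrδ (hδ0.trans hu)
    have h₂ : (r * δ) ^ 2 ≤ (x j - x m) ^ 2 := pow_le_pow_left₀ hrδ hv 2
    nlinarith [mul_le_mul_of_nonneg_right hr (sq_nonneg δ)]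
  simp only [seCross, Matrix.of_apply]
  rw [mul_assoc, ← Real.exp_nat_mul, ← Real.exp_add]
  gcongr
  rw [← mul_div_assoc, ← add_div]
  gcongr
  linarith

/-- The entries removed by the cut-off have row sums bounded by the noise variance. -/
lemma sum_sub_cutoff_le {n k : ℕ} {x : Fin n → ℝ} {σ2 l2 σn2 δ ε : ℝ} (hσ2 : 0 ≤ σ2)
    (hl2 : 0 < l2) (hσn2 : 0 ≤ σn2) (hδ0 : 0 ≤ δ) (hgap : ∀ i j, i < j → δ ≤ x j - x i)
    (hε : ∀ i j : Fin n, (k : ℤ) < |(i : ℤ) - (j : ℤ)| → seCross x x σ2 l2 i j ≤ ε)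
    (hεbound : ε ≤ 3 * σn2 * δ ^ 2 / (4 * l2) * Real.exp (-(3 * δ ^ 2) / (2 * l2)))
    (i : Fin n) :
    ∑ j, (seCross x x σ2 l2 - cutoff k (seCross x x σ2 l2)) i j ≤ σn2 := by
  set q : ℝ := Real.exp (-(3 * δ ^ 2) / (2 * l2)) with hq
  have hq0 : 0 ≤ q := (Real.exp_pos _).le
  have hq1 : q ≤ 1 := Real.exp_le_one_iff.mpr
    (div_nonpos_of_nonpos_of_nonneg (neg_nonpos.mpr (by positivity)) (by positivity))
  have hεq : ε ≤ σn2 / 2 * (1 - q) := by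
    have ht := mul_le_mul_of_nonneg_right (Real.add_one_le_exp (3 * δ ^ 2 / (2 * l2))) hq0
    have hinv : Real.exp (3 * δ ^ 2 / (2 * l2)) * q = 1 := by
      rw [hq, ← Real.exp_add, neg_div, add_neg_cancel, Real.exp_zero]
    calc ε ≤ 3 * σn2 * δ ^ 2 / (4 * l2) * q := hεbound
      _ = σn2 / 2 * (3 * δ ^ 2 / (2 * l2) * q) := by field_simp; ring
      _ ≤ σn2 / 2 * (1 - q) := by gcongr; linarith
  have hfar (i j : Fin n) (hij : (i : ℕ) + k < j) :
      seCross x x σ2 l2 i j ≤ σn2 / 2 * (q ^ ((j : ℕ) - i - k - 1) * (1 - q)) := by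
    let m : Fin n := ⟨i + k + 1, by have := j.isLt; omega⟩
    have hmval : (m : ℕ) = i + k + 1 := rfl
    calc seCross x x σ2 l2 i j
        ≤ seCross x x σ2 l2 i m * q ^ ((j : ℕ) - i - k - 1) :=
          seCross_le_mul_pow hσ2 hl2 hδ0 hgap (Fin.lt_def.mpr (by omega)) (by omega)
      _ ≤ σn2 / 2 * (1 - q) * q ^ ((j : ℕ) - i - k - 1) := by
          gcongr
          exact (hε i m (by rw [hmval, lt_abs]; omega)).trans hεq
      _ = _ := by ring
  have hentry (j : Fin n) : (seCross x x σ2 l2 - cutoff k (seCross x x σ2 l2)) i j ≤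
      (if (i : ℕ) + k < j then σn2 / 2 * (q ^ ((j : ℕ) - i - k - 1) * (1 - q)) else 0) +
      (if (j : ℕ) + k < i then σn2 / 2 * (q ^ ((i : ℕ) - j - k - 1) * (1 - q)) else 0) := by
    simp only [Matrix.sub_apply, cutoff, Matrix.of_apply]
    by_cases h₁ : (i : ℕ) + k < j
    · rw [if_neg (by rw [abs_le]; omega), if_pos h₁, if_neg (by omega), sub_zero, add_zero]
      exact hfar i j h₁
    by_cases h₂ : (j : ℕ) + k < i
    · rw [if_neg (by rw [abs_le]; omega), if_neg h₁, if_pos h₂, sub_zero, zero_add,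
        ← seCross_symm]
      exact hfar j i h₂
    rw [if_pos (by rw [abs_le]; omega), if_neg h₁, if_neg h₂, sub_self, add_zero]
  refine (sum_le_sum fun j _ => hentry j).trans ?_
  rw [sum_add_distrib, ← sum_filter, ← sum_filter, ← mul_sum, ← mul_sum]
  have hright := sum_pow_mul_one_sub_le_one (s := {j : Fin n | (i : ℕ) + k < j})
    (e := fun j => (j : ℕ) - i - k - 1) (fun a ha b hb hab => by
      simp only [coe_filter, Set.mem_ofPred_eq, mem_univ, true_and] at ha hb hab
      exact Fin.ext (by omega)) hq0 hq1
  have hleft := sum_pow_mul_one_sub_le_one (s := {j : Fin n | (j : ℕ) + k < i})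
    (e := fun j => (i : ℕ) - j - k - 1) (fun a ha b hb hab => by
      simp only [coe_filter, Set.mem_ofPred_eq, mem_univ, true_and] at ha hb hab
      exact Fin.ext (by omega)) hq0 hq1
  nlinarith [mul_le_mul_of_nonneg_left hright hσn2, mul_le_mul_of_nonneg_left hleft hσn2]

/-- **Theorem (Positive definiteness of the approximate joint prior covariance).**
The block matrix `[[L_k(K_{f,f}) + σ_n² I, K_{f,∗}], [K_{∗,f}, K_{∗,∗}]]`
is positive definite. -/
theorem approximate_joint_prior_posDef {n p : ℕ} (k : ℕ) (hk : k ≤ n)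
    (x : Fin n → ℝ) (hx : StrictMono x)
    (σ2 l2 σn2 δ : ℝ) (hσ2 : 0 < σ2) (hl2 : 0 < l2) (hσn2 : 0 < σn2)
    (hδ : IsLeast {d : ℝ | ∃ i j : Fin n, i ≠ j ∧ d = |x i - x j|} δ) (hδ0 : 0 < δ)
    (ε : ℝ)
    (hε : ∀ i j : Fin n, (k : ℤ) < |(i : ℤ) - (j : ℤ)| → seCross x x σ2 l2 i j ≤ ε)
    (hεbound : ε ≤ 3 * σn2 * δ ^ 2 / (4 * l2) * Real.exp (-(3 * δ ^ 2) / (2 * l2)))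
    (xs : Fin p → ℝ) (hxs : Function.Injective xs)
    (hdisj : ∀ (i : Fin n) (j : Fin p), xs j ≠ x i) :
    (Matrix.fromBlocks
      (cutoff k (seCross x x σ2 l2) + σn2 • (1 : Matrix (Fin n) (Fin n) ℝ))
      (seCross x xs σ2 l2)
      (seCross xs x σ2 l2)
      (seCross xs xs σ2 l2)).PosDef := by
  have hgap (i j : Fin n) (hij : i < j) : δ ≤ x j - x i := by
    have h := hδ.2 ⟨j, i, hij.ne', rfl⟩
    rwa [abs_of_pos (sub_pos.mpr (hx hij))] at h
  set K := seCross x x σ2 l2 with hK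
  set E := K - cutoff k K with hE
  have hsymm (i j : Fin n) : K j i = K i j := seCross_symm x x σ2 l2 i j
  have hE_herm : E.IsHermitian := by
    ext i j
    simp [hE, cutoff, hsymm i j, abs_sub_comm (j : ℤ) (i : ℤ)]
  have hE_nonneg (i j : Fin n) : 0 ≤ E i j := by
    have hpos : 0 ≤ K i j := by simp only [hK, seCross, Matrix.of_apply]; positivity
    simp only [hE, Matrix.sub_apply, cutoff, Matrix.of_apply]
    split_ifs <;> simp [hpos]
  have hE_psd := smul_one_sub_posSemidef_of_sum_le hE_herm hE_nonneg
    (sum_sub_cutoff_le hσ2.le hl2 hσn2.le hδ0.le hgap hε hεbound)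
  have hinj : Function.Injective (Sum.elim x xs) :=
    hx.injective.sumElim hxs fun i j => (hdisj i j).symm
  convert (squaredExponential_posDef hinj hσ2 hl2).add_posSemidef
    (fromBlocks_zero_posSemidef (p := Fin p) hE_psd) using 1
  ext (i | i) (j | j)
  · simp [hE, hK, seCross]
    ring
  all_goals simp [seCross]
end

section
/- Let x_1 < ⋯ < x_n be real points with δ = min_{i≠j} |x_i − x_j| > 0, let σ² > 0, ℓ² > 0, and let K_θ be the squared-exponential Gram matrix. Let k ≤ n and ε > 0 be such that (K_θ)_{ij} ≤ ε for all pairs with |i−j| > k. Then max_{i=1,…,n} Σ_{j : |i−j| > k} (K_θ)_{ij} < ε · (4ℓ²/(3δ²)) · exp(3δ²/(2ℓ²)). -/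
open Matrix BigOperators

/-- If consecutive points are at least `δ` apart, points `m` indices apart are at least `m * δ`
apart. -/
theorem add_nat_mul_le_of_separated {n : ℕ} {x : Fin n → ℝ} {δ : ℝ} (hx : StrictMono x)
    (hsep : ∀ i j : Fin n, i ≠ j → δ ≤ |x i - x j|) (m : ℕ) :
    ∀ i j : Fin n, (i : ℕ) + m = j → x i + m * δ ≤ x j := by
  induction m with
  | zero =>
    intro i j hij
    obtain rfl : i = j := Fin.ext (by simpa using hij)
    simp
  | succ m ih =>
    intro i j hij
    let p : Fin n := ⟨i + m, by omega⟩
    have hip := ih i p rfl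
    have hpj : p < j := Fin.lt_def.2 (show (i : ℕ) + m < j by omega)
    have hgap := hsep j p hpj.ne'
    rw [abs_of_pos (sub_pos.2 (hx hpj))] at hgap
    push_cast
    linarith

/-- Moving `m` separation lengths further away from `x i` multiplies the kernel by at most
`exp (-3 δ² / (2 ℓ²)) ^ m`. -/
theorem seGram_le_mul_exp_pow {n : ℕ} {x : Fin n → ℝ} {σ2 l2 δ : ℝ} (hσ2 : 0 < σ2)
    (hl2 : 0 < l2) (hδ : 0 < δ) {i j p : Fin n} {m : ℕ} (hp : δ ≤ |x i - x p|)
    (hj : |x i - x p| + m * δ ≤ |x i - x j|) :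
    seGram x σ2 l2 i j ≤ seGram x σ2 l2 i p * Real.exp (-(3 * δ ^ 2 / (2 * l2))) ^ m := by
  simp only [seGram, Matrix.of_apply]
  rw [← Real.exp_nat_mul, mul_assoc, ← Real.exp_add]
  gcongr
  have hm : (m : ℝ) ≤ (m : ℝ) ^ 2 := by exact_mod_cast Nat.le_self_pow two_ne_zero m
  have hm0 : (0 : ℝ) ≤ m := m.cast_nonneg
  have hsq : (x i - x p) ^ 2 + m * (3 * δ ^ 2) ≤ (x i - x j) ^ 2 := by
    have h1 : (|x i - x p| + m * δ) ^ 2 ≤ |x i - x j| ^ 2 := by gcongr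
    rw [sq_abs, add_sq, sq_abs] at h1
    have h2 : m * δ * δ ≤ m * δ * |x i - x p| := by gcongr
    have h3 : m * δ ^ 2 ≤ (m : ℝ) ^ 2 * δ ^ 2 := by gcongr
    linarith
  have hdiv : -(x i - x p) ^ 2 / (2 * l2) + m * -(3 * δ ^ 2 / (2 * l2))
      = (-(x i - x p) ^ 2 - m * (3 * δ ^ 2)) / (2 * l2) := by ring
  rw [hdiv]
  gcongr
  linarith

/-- Beyond the bandwidth `k` the kernel decays geometrically in the index distance. -/
theorem seGram_le_geometric {n k : ℕ} {x : Fin n → ℝ} (hx : StrictMono x) {σ2 l2 δ ε : ℝ}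
    (hσ2 : 0 < σ2) (hl2 : 0 < l2) (hδ : 0 < δ)
    (hsep : ∀ i j : Fin n, i ≠ j → δ ≤ |x i - x j|)
    (hε : ∀ i j : Fin n, (k : ℤ) < |(i : ℤ) - (j : ℤ)| → seGram x σ2 l2 i j ≤ ε)
    {i j : Fin n} (hij : (k : ℤ) < |(i : ℤ) - (j : ℤ)|) :
    seGram x σ2 l2 i j ≤
      ε * Real.exp (-(3 * δ ^ 2 / (2 * l2))) ^ (((i : ℤ) - (j : ℤ)).natAbs - (k + 1)) := by
  set m := ((i : ℤ) - (j : ℤ)).natAbs - (k + 1) with hm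
  have hk : k < ((i : ℤ) - (j : ℤ)).natAbs := by rwa [Int.abs_eq_natAbs, Nat.cast_lt] at hij
  obtain ⟨p, hp, hdist⟩ : ∃ p : Fin n, (k : ℤ) < |(i : ℤ) - (p : ℤ)| ∧
      |x i - x p| + m * δ ≤ |x i - x j| := by
    rcases lt_or_ge (i : ℕ) (j : ℕ) with h | h
    · let p : Fin n := ⟨i + (k + 1), by omega⟩
      have hpv : (p : ℕ) = i + (k + 1) := rfl
      have hgap := add_nat_mul_le_of_separated hx hsep m p j (by omega)
      have hxp : x i < x p := hx (Fin.lt_def.2 (by omega))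
      have hxj : x i < x j := hx (Fin.lt_def.2 h)
      refine ⟨p, by rw [Int.abs_eq_natAbs]; omega, ?_⟩
      rw [abs_of_neg (sub_neg.2 hxp), abs_of_neg (sub_neg.2 hxj)]
      linarith
    · let p : Fin n := ⟨i - (k + 1), by omega⟩
      have hpv : (p : ℕ) = i - (k + 1) := rfl
      have hgap := add_nat_mul_le_of_separated hx hsep m j p (by omega)
      have hxp : x p < x i := hx (Fin.lt_def.2 (by omega))
      have hxj : x j < x i := hx (Fin.lt_def.2 (by omega))
      refine ⟨p, by rw [Int.abs_eq_natAbs]; omega, ?_⟩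
      rw [abs_of_pos (sub_pos.2 hxp), abs_of_pos (sub_pos.2 hxj)]
      linarith
  have hne : i ≠ p := by
    rintro rfl
    rw [sub_self, abs_zero] at hp
    omega
  exact (seGram_le_mul_exp_pow hσ2 hl2 hδ (hsep i p hne) hdist).trans (by gcongr; exact hε i p hp)

/-- A sum of distinct powers of `q ∈ [0, 1)` is at most the full geometric series. -/
theorem sum_pow_le_geometric_of_injOn {ι : Type*} {s : Finset ι} {f : ι → ℕ}
    (hf : Set.InjOn f s) {q : ℝ} (hq0 : 0 ≤ q) (hq1 : q < 1) :
    ∑ j ∈ s, q ^ f j ≤ (1 - q)⁻¹ := by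
  rw [← Finset.sum_image (f := fun m => q ^ m) hf, ← tsum_geometric_of_lt_one hq0 hq1]
  exact (summable_geometric_of_lt_one hq0 hq1).sum_le_tsum _ fun m _ => pow_nonneg hq0 m

/-- The two tails of a row together contribute at most two geometric series. -/
theorem sum_pow_natAbs_sub_le {n : ℕ} (k : ℕ) (i : Fin n) {q : ℝ} (hq0 : 0 ≤ q) (hq1 : q < 1) :
    ∑ j ∈ Finset.univ.filter (fun j : Fin n => (k : ℤ) < |(i : ℤ) - (j : ℤ)|),
      q ^ (((i : ℤ) - (j : ℤ)).natAbs - (k + 1)) ≤ 2 * (1 - q)⁻¹ := by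
  rw [← Finset.sum_filter_add_sum_filter_not _ (fun j : Fin n => i < j), two_mul]
  refine add_le_add (sum_pow_le_geometric_of_injOn ?_ hq0 hq1)
    (sum_pow_le_geometric_of_injOn ?_ hq0 hq1)
  all_goals
    intro a ha b hb hab
    simp only [Finset.coe_filter, Finset.mem_filter, Finset.mem_univ, true_and, Set.mem_ofPred_eq,
      Int.abs_eq_natAbs, Fin.lt_def] at ha hb hab
    apply Fin.ext
    omega

theorem inv_one_sub_exp_neg_lt {a : ℝ} (ha : 0 < a) :
    (1 - Real.exp (-a))⁻¹ < a⁻¹ * Real.exp a := by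
  have h := Real.add_one_lt_exp ha.ne'
  have heq : (1 - Real.exp (-a))⁻¹ = (Real.exp a - 1)⁻¹ * Real.exp a := by
    have : Real.exp a - 1 ≠ 0 := by linarith
    rw [Real.exp_neg]
    field_simp
  rw [heq]
  gcongr
  linarith

/-- **Row-sum bound for the truncated tail.** If `(K_θ)_{ij} ≤ ε` whenever `|i−j| > k`,
then `max_i Σ_{j : |i−j| > k} (K_θ)_{ij} < ε (4ℓ²/(3δ²)) exp(3δ²/(2ℓ²))`. -/
theorem seGram_tail_row_sum_bound {n : ℕ} (k : ℕ) (hk : k ≤ n)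
    (x : Fin n → ℝ) (hx : StrictMono x)
    (σ2 l2 δ : ℝ) (hσ2 : 0 < σ2) (hl2 : 0 < l2)
    (hδ : IsLeast {d : ℝ | ∃ i j : Fin n, i ≠ j ∧ d = |x i - x j|} δ) (hδ0 : 0 < δ)
    (ε : ℝ) (hε0 : 0 < ε)
    (hε : ∀ i j : Fin n, (k : ℤ) < |(i : ℤ) - (j : ℤ)| → seGram x σ2 l2 i j ≤ ε) :
    (⨆ i : Fin n,
        ∑ j ∈ Finset.univ.filter (fun j : Fin n => (k : ℤ) < |(i : ℤ) - (j : ℤ)|),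
          seGram x σ2 l2 i j)
      < ε * (4 * l2 / (3 * δ ^ 2)) * Real.exp (3 * δ ^ 2 / (2 * l2)) := by
  have hsep : ∀ i j : Fin n, i ≠ j → δ ≤ |x i - x j| := fun i j hij => hδ.2 ⟨i, j, hij, rfl⟩
  obtain ⟨i₀, -⟩ := hδ.1
  have : Nonempty (Fin n) := ⟨i₀⟩
  set a := 3 * δ ^ 2 / (2 * l2) with ha
  have ha0 : 0 < a := by positivity
  have hq1 : Real.exp (-a) < 1 := Real.exp_zero ▸ Real.exp_lt_exp.2 (neg_lt_zero.2 ha0)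
  have hconst : 4 * l2 / (3 * δ ^ 2) = 2 * a⁻¹ := by
    rw [ha]
    field_simp
    norm_num
  refine (ciSup_le fun i => ?_ : _ ≤ ε * (2 * (1 - Real.exp (-a))⁻¹)).trans_lt ?_
  · calc _ ≤ ∑ j ∈ Finset.univ.filter (fun j : Fin n => (k : ℤ) < |(i : ℤ) - (j : ℤ)|),
          ε * Real.exp (-a) ^ (((i : ℤ) - (j : ℤ)).natAbs - (k + 1)) :=
        Finset.sum_le_sum fun j hj =>
          seGram_le_geometric hx hσ2 hl2 hδ0 hsep hε (Finset.mem_filter.1 hj).2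
      _ ≤ ε * (2 * (1 - Real.exp (-a))⁻¹) := by
        rw [← Finset.mul_sum]
        gcongr
        exact sum_pow_natAbs_sub_le k i (Real.exp_pos _).le hq1
  · rw [hconst, mul_assoc, mul_assoc]
    gcongr
    exact inv_one_sub_exp_neg_lt ha0
end
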